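/- For every element A of a complex Banach algebra and every integer l ≥ 2, the quadruple-angle formula holds: φ_l(4A) = 2^{−l} · ( φ_0(A)·φ_l(A) + φ_1(A)·φ_{l−1}(A) + Σ_{k=2}^{l} (1/(l−k)!)·φ_k(A) ). -/

import Mathlib

/-- The oscillatory function `φ_l(A) = ∑_{k=0}^∞ (-1)^k A^k / (2k+l)!` on a
complex Banach algebra. -/
noncomputable def osc {𝔸 : Type*} [NormedRing 𝔸] [NormedAlgebra ℂ 𝔸] [CompleteSpace 𝔸]
    (l : ℕ) (A : 𝔸) : 𝔸 :=
  ∑' k : ℕ, ((-1 : ℂ) ^ k / (Nat.factorial (2 * k + l) : ℂ)) • A ^ k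

theorem osc_summable_norm {𝔸 : Type*} [NormedRing 𝔸] [NormedAlgebra ℂ 𝔸] [CompleteSpace 𝔸]
    (l : ℕ) (A : 𝔸) :
    Summable fun k : ℕ => ‖((-1 : ℂ) ^ k / (Nat.factorial (2 * k + l) : ℂ)) • A ^ k‖ := by
  refine Summable.of_nonneg_of_le (fun _ => norm_nonneg _) (fun k => ?_)
    (NormedSpace.norm_expSeries_summable' (𝕂 := ℂ) A)
  rw [norm_smul, norm_smul]
  refine mul_le_mul_of_nonneg_right ?_ (norm_nonneg _)
  rw [norm_div, norm_pow, norm_neg, norm_one, one_pow, norm_inv, Complex.norm_natCast,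
    Complex.norm_natCast, one_div]
  have h1 : (0 : ℝ) < (Nat.factorial k : ℝ) := by exact_mod_cast Nat.factorial_pos k
  refine inv_anti₀ h1 ?_
  exact_mod_cast Nat.factorial_le (by omega)

theorem sum_range_pairs (f : ℕ → ℂ) (n : ℕ) :
    ∑ m ∈ Finset.range (2 * n), f m = ∑ i ∈ Finset.range n, (f (2 * i) + f (2 * i + 1)) := by
  induction n with
  | zero => simp
  | succ n ih =>
    rw [show 2 * (n + 1) = 2 * n + 1 + 1 by ring, Finset.sum_range_succ, Finset.sum_range_succ,
      ih, Finset.sum_range_succ, add_assoc]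

theorem sum_inv_fact (N : ℕ) :
    ∑ m ∈ Finset.range (N + 1), ((m.factorial : ℂ) * ((N - m).factorial : ℂ))⁻¹
      = 2 ^ N / (N.factorial : ℂ) := by
  rw [eq_div_iff (by exact_mod_cast N.factorial_ne_zero), Finset.sum_mul]
  have := Nat.sum_range_choose N
  rw [show (2 : ℂ) ^ N = ((2 ^ N : ℕ) : ℂ) by push_cast; rfl, ← this]
  push_cast
  refine Finset.sum_congr rfl fun m hm => ?_
  rw [Nat.cast_choose ℂ (by simpa [Nat.lt_succ_iff] using hm : m ≤ N)]
  rw [div_eq_mul_inv, mul_comm]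

theorem comb_id (n l : ℕ) (hl : 2 ≤ l) :
    (∑ i ∈ Finset.range (n + 1),
        (((2 * i).factorial : ℂ) * ((2 * (n - i) + l).factorial : ℂ))⁻¹)
    + (∑ i ∈ Finset.range (n + 1),
        (((2 * i + 1).factorial : ℂ) * ((2 * (n - i) + (l - 1)).factorial : ℂ))⁻¹)
    + ∑ k ∈ Finset.Icc 2 l, (((2 * n + k).factorial : ℂ) * ((l - k).factorial : ℂ))⁻¹
    = 2 ^ (2 * n + l) / ((2 * n + l).factorial : ℂ) := by
  rw [← sum_inv_fact, show 2 * n + l + 1 = 2 * (n + 1) + (l - 1) by omega,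
    Finset.sum_range_add _ (2 * (n + 1)) (l - 1), sum_range_pairs, Finset.sum_add_distrib]
  congr 1
  · congr 1
    · refine Finset.sum_congr rfl fun i hi => ?_
      have := Finset.mem_range.1 hi
      rw [show 2 * (n - i) + l = 2 * n + l - 2 * i by omega]
    · refine Finset.sum_congr rfl fun i hi => ?_
      have := Finset.mem_range.1 hi
      rw [show 2 * (n - i) + (l - 1) = 2 * n + l - (2 * i + 1) by omega]
  · rw [show Finset.Icc 2 l = Finset.Ico 2 (l + 1) by ext; simp,
      Finset.sum_Ico_eq_sum_range, show l + 1 - 2 = l - 1 by omega]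
    refine Finset.sum_congr rfl fun i hi => ?_
    rw [show l - (2 + i) = 2 * n + l - (2 * (n + 1) + i) by omega,
      show 2 * n + (2 + i) = 2 * (n + 1) + i by omega]

theorem osc_mul_hasSum {𝔸 : Type*} [NormedRing 𝔸] [NormedAlgebra ℂ 𝔸] [CompleteSpace 𝔸]
    (p q : ℕ) (A : 𝔸) :
    HasSum (fun n : ℕ => ((-1 : ℂ) ^ n * ∑ i ∈ Finset.range (n + 1),
      (((2 * i + p).factorial : ℂ) * ((2 * (n - i) + q).factorial : ℂ))⁻¹) • A ^ n)
      (osc p A * osc q A) := by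
  have hs := (summable_norm_sum_mul_range_of_summable_norm
    (osc_summable_norm p A) (osc_summable_norm q A)).of_norm.hasSum
  rw [← tsum_mul_tsum_eq_tsum_sum_range_of_summable_norm
    (osc_summable_norm p A) (osc_summable_norm q A)] at hs
  refine Eq.mp (congrArg (fun f => HasSum f (osc p A * osc q A)) (funext fun n => ?_)) hs
  symm
  rw [Finset.mul_sum, Finset.sum_smul]
  refine Finset.sum_congr rfl fun i hi => ?_
  have hin : i + (n - i) = n := by
    have := Finset.mem_range.1 hi
    omega
  rw [smul_mul_smul_comm, ← pow_add, hin]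
  congr 1
  rw [mul_inv, div_mul_div_comm, ← pow_add, hin, div_eq_mul_inv, mul_inv]

/-- the quadruple-angle formula
`φ_l(4A) = 2^{-l} (φ_0(A) φ_l(A) + φ_1(A) φ_{l-1}(A) + ∑_{k=2}^l φ_k(A)/(l-k)!)`. -/
theorem osc_quadruple_angle {𝔸 : Type*} [NormedRing 𝔸] [NormedAlgebra ℂ 𝔸]
    [CompleteSpace 𝔸] (A : 𝔸) (l : ℕ) (hl : 2 ≤ l) :
    osc l ((4 : ℂ) • A) =
      (((2 : ℂ) ^ l))⁻¹ •
        (osc 0 A * osc l A + osc 1 A * osc (l - 1) A +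
          ∑ k ∈ Finset.Icc 2 l, ((Nat.factorial (l - k) : ℂ))⁻¹ • osc k A) := by
  have h3 := hasSum_sum (s := Finset.Icc 2 l) fun k _ =>
    ((osc_summable_norm k A).of_norm.hasSum).const_smul ((Nat.factorial (l - k) : ℂ))⁻¹
  have h := (((osc_mul_hasSum 0 l A).add (osc_mul_hasSum 1 (l - 1) A)).add h3).const_smul
    (((2 : ℂ) ^ l))⁻¹
  refine Eq.trans ?_ h.tsum_eq
  unfold osc
  refine tsum_congr fun n => ?_
  simp only [smul_smul, ← Finset.sum_smul, ← add_smul, smul_pow, add_zero]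
  congr 1
  have hc := comb_id n l hl
  have h2 : ∑ k ∈ Finset.Icc 2 l, ((Nat.factorial (l - k) : ℂ))⁻¹ *
      ((-1 : ℂ) ^ n / (Nat.factorial (2 * n + k) : ℂ)) = (-1 : ℂ) ^ n *
      ∑ k ∈ Finset.Icc 2 l, (((2 * n + k).factorial : ℂ) * ((l - k).factorial : ℂ))⁻¹ := by
    rw [Finset.mul_sum]
    refine Finset.sum_congr rfl fun k _ => ?_
    rw [mul_inv, div_eq_mul_inv]; ring
  rw [h2, ← mul_add, ← mul_add, hc, pow_add, pow_mul]
  have : (2 : ℂ) ^ l ≠ 0 := pow_ne_zero _ two_ne_zero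
  field_simp
  norm_num
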